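/- A nonempty C∞-word is a proper prefix of some word of MF(C^∞) if and only if it is a left minimal word. -/

import Mathlib

/- Common framework: words over the alphabet Σ = {1,2} (represented as natural
numbers), run-length encoding, the derivative D, k-differentiable words C^k,
C∞-words, heights, roots, primitives, minimal/maximal words, simple extensions,
minimal forbidden words, and the left frontier Ψ. -/

namespace CinftyWords

/-- A word is a finite sequence of natural numbers. -/
abbrev Word := List ℕ

/-- `w` is a word over the alphabet Σ = {1,2}. -/
def IsWord (w : Word) : Prop := ∀ x ∈ w, x = 1 ∨ x = 2

/-- Complement of a letter: exchanges 1 and 2. -/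
def bar (x : ℕ) : ℕ := 3 - x

/-- Letterwise complement of a word. -/
def comp (w : Word) : Word := w.map bar

/-- Run-length encoding Δ: the sequence of lengths of maximal runs of equal
consecutive letters. -/
def rle (w : Word) : Word := (w.splitBy (· == ·)).map List.length

/-- Drop the first run if it has length 1. -/
def dropFirstRun1 (g : List (List ℕ)) : List (List ℕ) :=
  match g with
  | [] => []
  | r :: rs => if r.length = 1 then rs else r :: rs

/-- The derivative `D w`: the run-length encoding of the word obtained from `w`
by deleting its first and/or last run when that run has length 1. -/
def D (w : Word) : Word :=
  ((dropFirstRun1 ((dropFirstRun1 (w.splitBy (· == ·))).reverse)).reverse).map List.length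

/-- `w` is differentiable: `w` is a word over Σ and so is its run-length encoding. -/
def Diffble (w : Word) : Prop := IsWord w ∧ IsWord (rle w)

/-- The set C^k of k-differentiable words: `D^[j] w` is differentiable for all `j < k`
(so that `D^[k] w` is defined). -/
def CK (k : ℕ) : Set Word := {w | IsWord w ∧ ∀ j < k, Diffble (D^[j] w)}

/-- The set C∞ of words differentiable arbitrarily many times. -/
def Cinf : Set Word := {w | ∀ k : ℕ, w ∈ CK k}

/-- The height of a C∞-word: the least `k` with `D^[k] w = []`. -/
noncomputable def height (w : Word) : ℕ := sInf {k | D^[k] w = []}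

/-- The root of a C∞-word: `D^[height w - 1] w`. -/
noncomputable def root (w : Word) : Word := D^[height w - 1] w

/-- `v` is a primitive of `w`: `v` is differentiable and `D v = w`. -/
def IsPrimitive (v w : Word) : Prop := Diffble v ∧ D v = w

/-- A nonempty C∞-word is maximal if each `D^[j] w` (for `j ≤ height w - 2`) is a
primitive of `D^[j+1] w` of maximal length (vacuously true when `height w = 1`). -/
def MaximalWord (w : Word) : Prop :=
  w ∈ Cinf ∧ w ≠ [] ∧ ∀ j, j + 2 ≤ height w →
    ∀ v, IsPrimitive v (D^[j + 1] w) → v.length ≤ (D^[j] w).length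

/-- A nonempty C∞-word is minimal if each `D^[j] w` (for `j ≤ height w - 2`) is a
primitive of `D^[j+1] w` of minimal length (vacuously true when `height w = 1`). -/
def MinimalWord (w : Word) : Prop :=
  w ∈ Cinf ∧ w ≠ [] ∧ ∀ j, j + 2 ≤ height w →
    ∀ v, IsPrimitive v (D^[j + 1] w) → (D^[j] w).length ≤ v.length

/-- `w` is right maximal: a suffix of a maximal word. -/
def RightMaximal (w : Word) : Prop := ∃ v, MaximalWord v ∧ w <:+ v

/-- `w` is left maximal: a prefix of a maximal word. -/
def LeftMaximal (w : Word) : Prop := ∃ v, MaximalWord v ∧ w <+: v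

/-- `w` is right minimal: a suffix of a minimal word. -/
def RightMinimal (w : Word) : Prop := ∃ v, MinimalWord v ∧ w <:+ v

/-- `w` is left minimal: a prefix of a minimal word. -/
def LeftMinimal (w : Word) : Prop := ∃ v, MinimalWord v ∧ w <+: v

/-- `w` is right doubly extendable: both `w1` and `w2` are C∞-words. -/
def RightDoublyExt (w : Word) : Prop := w ++ [1] ∈ Cinf ∧ w ++ [2] ∈ Cinf

/-- `w` is left doubly extendable: both `1w` and `2w` are C∞-words. -/
def LeftDoublyExt (w : Word) : Prop := 1 :: w ∈ Cinf ∧ 2 :: w ∈ Cinf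

/-- `w` is fully extendable: `1w1`, `1w2`, `2w1`, `2w2` are all C∞-words. -/
def FullyExt (w : Word) : Prop :=
  ∀ x, (x = 1 ∨ x = 2) → ∀ y, (y = 1 ∨ y = 2) → x :: (w ++ [y]) ∈ Cinf

/-- `w'` is a right simple extension of `w`: `w' = w ++ s` is a C∞-word and at each
step the extension by the complementary letter is not a C∞-word. -/
def RightSimpleExt (w w' : Word) : Prop :=
  w' ∈ Cinf ∧ ∃ s : Word, IsWord s ∧ w' = w ++ s ∧
    ∀ i < s.length, w ++ s.take i ++ [bar (s.getD i 0)] ∉ Cinf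

/-- `w'` is a left simple extension of `w`. -/
def LeftSimpleExt (w w' : Word) : Prop := RightSimpleExt w.reverse w'.reverse

/-- `w'` is a simple extension of `w`: a right simple extension of a left simple
extension of `w`. -/
def SimpleExt (w w' : Word) : Prop := ∃ v, LeftSimpleExt w v ∧ RightSimpleExt v w'

/-- `m` is the maximal extension of `w`: a simple extension of `w` of maximal length. -/
def IsMaximalExtension (w m : Word) : Prop :=
  SimpleExt w m ∧ ∀ v, SimpleExt w v → v.length ≤ m.length

/-- A language is factorial if it is closed under taking factors. -/
def Factorial (F : Set Word) : Prop := ∀ v ∈ F, ∀ u, u <:+: v → u ∈ F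

/-- A language is anti-factorial if no word of it is a proper factor of another
word of it. -/
def AntiFactorial (M : Set Word) : Prop := ∀ u ∈ M, ∀ v ∈ M, u ≠ v → ¬ u <:+: v

/-- The set of minimal forbidden words of a (factorial) language `F`: words not
in `F` whose maximal proper prefix and maximal proper suffix are both in `F`. -/
def MF (F : Set Word) : Set Word := {v | v ∉ F ∧ v.dropLast ∈ F ∧ v.tail ∈ F}

/-- The height of a minimal forbidden word of C∞: `k + 1`, where `k` is the
(unique) integer such that `w` is k-differentiable and `D^[k] w ∈ {111, 222}`. -/
noncomputable def MFheight (w : Word) : ℕ :=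
  sInf {k | w ∈ CK k ∧ (D^[k] w = [1, 1, 1] ∨ D^[k] w = [2, 2, 2])} + 1

/-- The left frontier Ψ of a C∞-word: the word of length `height w` over {0,1,2}
recording the first letter of each derivative, with `2` replaced by `0` when the
first two letters of the previous derivative are distinct. -/
noncomputable def psi (w : Word) : List ℕ :=
  (List.range (height w)).map (fun i =>
    if i = 0 then w.getD 0 0
    else if (D^[i] w).getD 0 0 = 2 ∧ (D^[i - 1] w).getD 0 0 ≠ (D^[i - 1] w).getD 1 0 then 0
    else (D^[i] w).getD 0 0)

end CinftyWords

namespace CinftyWords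

/-- A letter of the alphabet Σ = {1,2}. -/
def IsLetter (a : ℕ) : Prop := a = 1 ∨ a = 2

/-- The word over Σ with first letter `a` and run lengths `r`. -/
def expand : ℕ → List ℕ → Word
  | _, [] => []
  | a, n :: r => List.replicate n a ++ expand (bar a) r

/-- Remove the first entry if it is `1`. -/
def trimLeft : List ℕ → List ℕ
  | [] => []
  | n :: r => if n = 1 then r else n :: r

/-- Remove the last entry if it is `1`. -/
def trimRight (r : List ℕ) : List ℕ := (trimLeft r.reverse).reverse

lemma IsLetter.bar {a : ℕ} (ha : IsLetter a) : IsLetter (bar a) := by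
  rcases ha with rfl | rfl <;> simp [IsLetter, CinftyWords.bar]

lemma IsLetter.bar_bar {a : ℕ} (ha : IsLetter a) : CinftyWords.bar (CinftyWords.bar a) = a := by
  rcases ha with rfl | rfl <;> rfl

lemma IsLetter.ne_bar {a : ℕ} (ha : IsLetter a) : a ≠ CinftyWords.bar a := by
  rcases ha with rfl | rfl <;> simp [CinftyWords.bar]

lemma IsLetter.eq_bar_of_ne {a b : ℕ} (ha : IsLetter a) (hb : IsLetter b) (h : a ≠ b) :
    b = CinftyWords.bar a := by
  rcases ha with rfl | rfl <;> rcases hb with rfl | rfl <;> simp_all [CinftyWords.bar]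

lemma isWord_cons {a : ℕ} {w : Word} : IsWord (a :: w) ↔ IsLetter a ∧ IsWord w := by
  simp [IsWord, IsLetter]

lemma isWord_append {v w : Word} : IsWord (v ++ w) ↔ IsWord v ∧ IsWord w := by
  simp [IsWord, or_imp, forall_and]

lemma isWord_nil : IsWord [] := by simp [IsWord]

lemma isWord_reverse {w : Word} : IsWord w.reverse ↔ IsWord w := by simp [IsWord]

lemma IsWord.zero_notMem {w : Word} (hw : IsWord w) : 0 ∉ w := by
  intro h
  rcases hw 0 h with h | h <;> simp at h

lemma isWord_expand {a : ℕ} (ha : IsLetter a) (r : List ℕ) : IsWord (expand a r) := by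
  induction r generalizing a with
  | nil => exact isWord_nil
  | cons n r ih =>
    rw [expand, isWord_append]
    refine ⟨fun x hx => ?_, ih ha.bar⟩
    rw [List.eq_of_mem_replicate hx]
    exact ha

lemma rle_expand {a : ℕ} (ha : IsLetter a) {r : List ℕ} (hr : 0 ∉ r) : rle (expand a r) = r := by
  induction r generalizing a with
  | nil => rfl
  | cons n r ih =>
    obtain ⟨hn, hr⟩ : 0 ≠ n ∧ 0 ∉ r := by simpa using hr
    have hsplit : (expand a (n :: r)).splitBy (· == ·) =
        (List.replicate n a).splitBy (· == ·) ++ (expand (bar a) r).splitBy (· == ·) := by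
      apply List.splitBy_append
      intro x hx y hy
      have hx' : x = a := List.eq_of_mem_replicate (List.mem_of_mem_getLast? hx)
      have hy' : y = bar a := by
        cases r with
        | nil => simp [expand] at hy
        | cons m r =>
          have hm : m ≠ 0 := by rintro rfl; simp at hr
          rw [expand, List.head?_append_of_ne_nil _ (by simp [hm])] at hy
          exact List.eq_of_mem_replicate (List.mem_of_mem_head? hy)
      subst hx' hy'
      simpa using ha.ne_bar
    have hrep : (List.replicate n a).splitBy (· == ·) = [List.replicate n a] :=
      List.splitBy_of_isChain (by simpa using hn.symm) (List.isChain_replicate_of_rel n (by simp))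
    rw [rle, hsplit, hrep, List.map_append, ← rle, ih ha.bar hr]
    simp

lemma exists_eq_expand {w : Word} (hw : IsWord w) :
    ∃ a r, IsLetter a ∧ 0 ∉ r ∧ w = expand a r := by
  induction w with
  | nil => exact ⟨1, [], Or.inl rfl, by simp, rfl⟩
  | cons c t ih =>
    obtain ⟨hc, ht⟩ := isWord_cons.1 hw
    obtain ⟨a, r, ha, hr, rfl⟩ := ih ht
    cases r with
    | nil => exact ⟨c, [1], hc, by simp, rfl⟩
    | cons n r =>
      by_cases h : c = a
      · subst h
        exact ⟨c, (n + 1) :: r, hc, by simp_all, by simp [expand, List.replicate_succ]⟩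
      · refine ⟨c, 1 :: n :: r, hc, by simpa using hr, ?_⟩
        rw [hc.eq_bar_of_ne ha h]
        simp [expand]

lemma diffble_iff_expand {w : Word} :
    Diffble w ↔ ∃ a r, IsLetter a ∧ IsWord r ∧ w = expand a r := by
  constructor
  · rintro ⟨hw, hr⟩
    obtain ⟨a, r, ha, h0, rfl⟩ := exists_eq_expand hw
    rw [rle_expand ha h0] at hr
    exact ⟨a, r, ha, hr, rfl⟩
  · rintro ⟨a, r, ha, hr, rfl⟩
    refine ⟨isWord_expand ha r, ?_⟩
    rwa [rle_expand ha hr.zero_notMem]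

lemma map_length_dropFirstRun1 (g : List (List ℕ)) :
    (dropFirstRun1 g).map List.length = trimLeft (g.map List.length) := by
  cases g with
  | nil => rfl
  | cons x g => simp only [dropFirstRun1, trimLeft, List.map_cons]; split_ifs <;> rfl

lemma D_eq_trim (w : Word) : D w = trimRight (trimLeft (rle w)) := by
  rw [D, List.map_reverse, map_length_dropFirstRun1, List.map_reverse, map_length_dropFirstRun1]
  rfl

lemma D_expand {a : ℕ} (ha : IsLetter a) {r : List ℕ} (hr : IsWord r) :
    D (expand a r) = trimRight (trimLeft r) := by
  rw [D_eq_trim, rle_expand ha hr.zero_notMem]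

lemma D_nil : D [] = [] := rfl

lemma splitBy_reverse (w : Word) :
    w.reverse.splitBy (· == ·) = ((w.splitBy (· == ·)).map List.reverse).reverse := by
  rw [List.splitBy_eq_iff]
  refine ⟨?_, by simp, ?_, ?_⟩
  · conv_lhs => rw [← List.flatten_splitBy (· == ·) w, List.reverse_flatten]
  · intro m hm
    obtain ⟨l, hl, rfl⟩ : ∃ l ∈ w.splitBy (· == ·), l.reverse = m := by simpa using hm
    rw [List.isChain_reverse]
    exact (List.isChain_of_mem_splitBy hl).imp fun x y h => by rw [beq_iff_eq] at h ⊢; exact h.symm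
  · rw [List.isChain_reverse, List.isChain_map]
    refine (List.isChain_getLast_head_splitBy (· == ·) w).imp ?_
    rintro x y ⟨hx, hy, h⟩
    refine ⟨by simpa using hy, by simpa using hx, ?_⟩
    rw [beq_eq_false_iff_ne] at h ⊢
    simpa using h.symm

lemma rle_reverse (w : Word) : rle w.reverse = (rle w).reverse := by
  rw [rle, splitBy_reverse, rle, List.map_reverse, List.map_map]
  congr 2
  funext l
  simp

lemma trimRight_nil : trimRight [] = [] := rfl

lemma trimRight_concat (r : List ℕ) (n : ℕ) :
    trimRight (r ++ [n]) = if n = 1 then r else r ++ [n] := by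
  simp only [trimRight, List.reverse_append, List.reverse_singleton, List.singleton_append, trimLeft]
  split_ifs <;> simp

lemma trimRight_cons (n : ℕ) {r : List ℕ} (hr : r ≠ []) :
    trimRight (n :: r) = n :: trimRight r := by
  obtain ⟨s, m, rfl⟩ := List.eq_nil_or_concat r |>.resolve_left hr
  rw [List.concat_eq_append, ← List.cons_append, trimRight_concat, trimRight_concat]
  split_ifs <;> rfl

lemma trimRight_singleton (n : ℕ) : trimRight [n] = if n = 1 then [] else [n] :=
  trimRight_concat [] n

lemma trimRight_trimLeft (r : List ℕ) : trimRight (trimLeft r) = trimLeft (trimRight r) := by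
  cases r with
  | nil => rfl
  | cons n r =>
    by_cases hr : r = []
    · subst hr
      by_cases hn : n = 1 <;> simp [trimRight_singleton, trimLeft, hn, trimRight_nil]
    · rw [trimRight_cons n hr]
      simp only [trimLeft]
      split_ifs
      · rfl
      · exact trimRight_cons n hr

lemma D_reverse (w : Word) : D w.reverse = (D w).reverse := by
  rw [D_eq_trim, D_eq_trim, rle_reverse, trimRight_trimLeft (rle w)]
  simp [trimRight]

lemma diffble_reverse {w : Word} : Diffble w.reverse ↔ Diffble w := by
  rw [Diffble, Diffble, rle_reverse, isWord_reverse, isWord_reverse]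

lemma iterate_D_nil (j : ℕ) : D^[j] [] = [] := Function.iterate_fixed D_nil j

lemma mem_Cinf_iff {w : Word} : w ∈ Cinf ↔ ∀ j, Diffble (D^[j] w) :=
  ⟨fun h j => (h (j + 1)).2 j (Nat.lt_succ_self j), fun h _ => ⟨(h 0).1, fun j _ => h j⟩⟩

lemma mem_Cinf_iff_D {w : Word} : w ∈ Cinf ↔ Diffble w ∧ D w ∈ Cinf := by
  simp only [mem_Cinf_iff]
  refine ⟨fun h => ⟨h 0, fun j => h (j + 1)⟩, fun ⟨h₀, h⟩ j => ?_⟩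
  cases j with
  | zero => exact h₀
  | succ j => exact h j

lemma nil_mem_Cinf : [] ∈ Cinf :=
  mem_Cinf_iff.2 fun j => by rw [iterate_D_nil]; exact ⟨isWord_nil, isWord_nil⟩

lemma length_trimLeft_le (r : List ℕ) : (trimLeft r).length ≤ r.length := by
  cases r with
  | nil => rfl
  | cons n r => simp only [trimLeft]; split_ifs <;> simp

lemma length_trimRight_le (r : List ℕ) : (trimRight r).length ≤ r.length := by
  simpa [trimRight] using length_trimLeft_le r.reverse

lemma length_expand (a : ℕ) (r : List ℕ) : (expand a r).length = r.sum := by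
  induction r generalizing a with
  | nil => rfl
  | cons n r ih => simp [expand, ih]

lemma length_le_sum {r : List ℕ} (hr : IsWord r) : r.length ≤ r.sum := by
  induction r with
  | nil => simp
  | cons n r ih =>
    obtain ⟨hn, hr⟩ := isWord_cons.1 hr
    have := ih hr
    rcases hn with rfl | rfl <;> simp <;> omega

lemma length_D_lt {w : Word} (hw : Diffble w) (hne : w ≠ []) : (D w).length < w.length := by
  obtain ⟨a, r, ha, hr, rfl⟩ := diffble_iff_expand.1 hw
  rw [D_expand ha hr, length_expand]
  cases r with
  | nil => exact absurd rfl hne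
  | cons n r =>
    obtain ⟨hn, hr⟩ := isWord_cons.1 hr
    have h₁ := length_le_sum hr
    rcases hn with rfl | rfl
    · have h₂ := length_trimRight_le r
      simp [trimLeft]
      omega
    · have h₂ := length_trimRight_le (2 :: r)
      simp [trimLeft] at h₂ ⊢
      omega

/-- `w` does not start with `abb` for distinct letters `a` and `b`. -/
def TightStart (w : Word) : Prop := ∀ a b, a ≠ b → ¬ [a, b, b] <+: w

lemma tightStart_nil : TightStart [] := by simp [TightStart]

lemma TightStart.of_prefix {v w : Word} (hw : TightStart w) (h : v <+: w) : TightStart v :=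
  fun a b hab h' => hw a b hab (h'.trans h)

lemma tightStart_expand {a : ℕ} (ha : IsLetter a) {r : List ℕ} (hr : IsWord r) :
    TightStart (expand a r) ↔ ¬ [1, 2] <+: r := by
  constructor
  · rintro h ⟨s, rfl⟩
    exact h a (bar a) ha.ne_bar ⟨expand (bar (bar a)) s, by simp [expand, List.replicate]⟩
  · intro h x y hxy hp
    rcases r with _ | ⟨n, _ | ⟨m, r⟩⟩
    · simp [expand] at hp
    · rcases (isWord_cons.1 hr).1 with rfl | rfl <;> simp [expand, List.replicate] at hp
    · simp only [isWord_cons] at hr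
      obtain ⟨rfl | rfl, rfl | rfl, hr⟩ := hr
      · cases r <;> simp [expand, List.replicate, List.cons_prefix_cons] at hp
        rename_i k r
        obtain ⟨rfl, rfl, hp⟩ := hp
        rw [ha.bar_bar] at hp
        rcases (isWord_cons.1 hr).1 with rfl | rfl <;>
          simp [List.replicate, List.cons_prefix_cons] at hp <;> omega
      · exact h ⟨r, rfl⟩
      · simp [expand, List.replicate, List.cons_prefix_cons] at hp
        omega
      · simp [expand, List.replicate, List.cons_prefix_cons] at hp
        omega

lemma expand_tail (a : ℕ) {r : List ℕ} (hr : IsWord r) :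
    (∃ s, r = 1 :: s ∧ (expand a r).tail = expand (bar a) s) ∨
    (∃ s, r = 2 :: s ∧ (expand a r).tail = expand a (1 :: s)) ∨ r = [] := by
  rcases r with _ | ⟨n, r⟩
  · simp
  · rcases (isWord_cons.1 hr).1 with rfl | rfl <;> simp [expand, List.replicate]

lemma Diffble.tail {w : Word} (hw : Diffble w) : Diffble w.tail := by
  obtain ⟨a, r, ha, hr, rfl⟩ := diffble_iff_expand.1 hw
  rcases expand_tail a hr with ⟨s, rfl, h⟩ | ⟨s, rfl, h⟩ | rfl
  · exact diffble_iff_expand.2 ⟨_, s, ha.bar, (isWord_cons.1 hr).2, h⟩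
  · exact diffble_iff_expand.2
      ⟨a, 1 :: s, ha, isWord_cons.2 ⟨Or.inl rfl, (isWord_cons.1 hr).2⟩, h⟩
  · exact hw

lemma trimRight_two_cons (r : List ℕ) : trimRight (2 :: r) = 2 :: trimRight r := by
  by_cases hr : r = []
  · subst hr; rfl
  · exact trimRight_cons 2 hr

lemma D_tail_of_tightStart {w : Word} (hw : Diffble w) (ht : TightStart w) :
    D w.tail = (D w).tail := by
  obtain ⟨a, r, ha, hr, rfl⟩ := diffble_iff_expand.1 hw
  rw [tightStart_expand ha hr] at ht
  rcases expand_tail a hr with ⟨s, rfl, h⟩ | ⟨s, rfl, h⟩ | rfl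
  · have hs := (isWord_cons.1 hr).2
    rw [h, D_expand ha hr, D_expand ha.bar hs]
    rcases s with _ | ⟨n, s⟩
    · rfl
    · rcases (isWord_cons.1 hs).1 with rfl | rfl
      · by_cases hs : s = []
        · subst hs; rfl
        · simp [trimLeft, trimRight_cons 1 hs]
      · exact absurd ⟨s, rfl⟩ ht
  · have hs := (isWord_cons.1 hr).2
    rw [h, D_expand ha hr, D_expand ha (isWord_cons.2 ⟨Or.inl rfl, hs⟩)]
    simp [trimLeft, trimRight_two_cons]
  · rfl

lemma D_tail_of_not_tightStart {w : Word} (hw : Diffble w) (ht : ¬ TightStart w) :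
    D w.tail = D w := by
  obtain ⟨a, r, ha, hr, rfl⟩ := diffble_iff_expand.1 hw
  rw [tightStart_expand ha hr, not_not] at ht
  obtain ⟨s, rfl⟩ := ht
  have hs : IsWord (2 :: s) := (isWord_cons.1 hr).2
  rcases expand_tail a hr with ⟨t, h', h⟩ | ⟨t, h', h⟩ | h'
  · obtain rfl : 2 :: s = t := by simpa using h'
    rw [h, D_expand ha hr, D_expand ha.bar hs]
    rfl
  · simp at h'
  · simp at h'

lemma D_ne_nil_of_not_tightStart {w : Word} (hw : Diffble w) (ht : ¬ TightStart w) :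
    D w ≠ [] := by
  obtain ⟨a, r, ha, hr, rfl⟩ := diffble_iff_expand.1 hw
  rw [tightStart_expand ha hr, not_not] at ht
  obtain ⟨s, rfl⟩ := ht
  rw [D_expand ha hr]
  change trimRight (2 :: s) ≠ []
  simp [trimRight_two_cons]

lemma dropLast_eq_reverse_tail (w : Word) : w.dropLast = w.reverse.tail.reverse := by
  rw [List.tail_reverse, List.reverse_reverse]

lemma Diffble.dropLast {w : Word} (hw : Diffble w) : Diffble w.dropLast := by
  rw [dropLast_eq_reverse_tail, diffble_reverse]
  exact (diffble_reverse.2 hw).tail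

lemma D_dropLast_of_tightStart {w : Word} (hw : Diffble w) (ht : TightStart w.reverse) :
    D w.dropLast = (D w).dropLast := by
  rw [dropLast_eq_reverse_tail, D_reverse, D_tail_of_tightStart (diffble_reverse.2 hw) ht,
    D_reverse, ← dropLast_eq_reverse_tail]

lemma D_dropLast_of_not_tightStart {w : Word} (hw : Diffble w) (ht : ¬ TightStart w.reverse) :
    D w.dropLast = D w := by
  rw [dropLast_eq_reverse_tail, D_reverse, D_tail_of_not_tightStart (diffble_reverse.2 hw) ht,
    D_reverse, List.reverse_reverse]

lemma D_dropLast_prefix {w : Word} (hw : Diffble w) : D w.dropLast <+: D w := by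
  by_cases ht : TightStart w.reverse
  · rw [D_dropLast_of_tightStart hw ht]
    exact List.dropLast_prefix _
  · rw [D_dropLast_of_not_tightStart hw ht]

lemma prefix_dropLast_of_ne {v w : Word} (h : v <+: w) (hne : v ≠ w) : v <+: w.dropLast := by
  rcases List.eq_nil_or_concat w with rfl | ⟨u, x, rfl⟩
  · exact h
  · rw [List.concat_eq_append, List.prefix_concat_iff] at h
    rw [List.concat_eq_append] at hne ⊢
    simpa using h.resolve_left hne

lemma Diffble.D_prefix {v w : Word} (hw : Diffble w) (h : v <+: w) : D v <+: D w := by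
  induction hn : w.length generalizing w with
  | zero =>
    obtain rfl := List.length_eq_zero_iff.1 hn
    rw [List.prefix_nil.1 h]
  | succ n ih =>
    by_cases hvw : v = w
    · rw [hvw]
    · exact (ih hw.dropLast (prefix_dropLast_of_ne h hvw) (by simp [hn])).trans
        (D_dropLast_prefix hw)

/-- Every derivative of `w` is tight at its start. -/
def HereditarilyTight (w : Word) : Prop := ∀ j, TightStart (D^[j] w)

lemma hereditarilyTight_iff {w : Word} :
    HereditarilyTight w ↔ TightStart w ∧ HereditarilyTight (D w) := by
  refine ⟨fun h => ⟨h 0, fun j => h (j + 1)⟩, fun ⟨h₀, h⟩ j => ?_⟩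
  cases j with
  | zero => exact h₀
  | succ j => exact h j

lemma hereditarilyTight_nil : HereditarilyTight [] := fun j => by
  rw [iterate_D_nil]
  exact tightStart_nil

lemma HereditarilyTight.of_prefix {v w : Word} (hw : w ∈ Cinf) (h : HereditarilyTight w)
    (hvw : v <+: w) : HereditarilyTight v := by
  intro j
  refine (h j).of_prefix ?_
  induction j generalizing v w with
  | zero => exact hvw
  | succ j ih =>
    obtain ⟨hd, hD⟩ := mem_Cinf_iff_D.1 hw
    exact ih hD (hereditarilyTight_iff.1 h).2 (hd.D_prefix hvw)

lemma MF.isWord {m w : Word} (hm : m ∈ MF Cinf) (hwm : w <+: m) (hne : w ≠ m) (hw : w ≠ []) :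
    IsWord m := by
  obtain ⟨-, hm₁, hm₂⟩ := hm
  rcases m with _ | ⟨a, _ | ⟨b, m⟩⟩
  · exact isWord_nil
  · exact absurd (List.prefix_nil.1 (prefix_dropLast_of_ne hwm hne)) hw
  · exact isWord_cons.2 ⟨(hm₁ 0).1 a (by simp), (hm₂ 0).1⟩

lemma D_mem_MF {m : Word} (hm : m ∈ MF Cinf) (hd : Diffble m) :
    D m ∈ MF Cinf ∧ TightStart m ∧ D m.dropLast = (D m).dropLast := by
  obtain ⟨hm₀, hm₁, hm₂⟩ := hm
  have hDm : D m ∉ Cinf := fun h => hm₀ (mem_Cinf_iff_D.2 ⟨hd, h⟩)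
  have h₁ := (mem_Cinf_iff_D.1 hm₁).2
  have h₂ := (mem_Cinf_iff_D.1 hm₂).2
  have ht : TightStart m := by
    by_contra ht
    rw [D_tail_of_not_tightStart hd ht] at h₂
    exact hDm h₂
  have ht' : TightStart m.reverse := by
    by_contra ht
    rw [D_dropLast_of_not_tightStart hd ht] at h₁
    exact hDm h₁
  rw [D_tail_of_tightStart hd ht] at h₂
  rw [D_dropLast_of_tightStart hd ht'] at h₁ ⊢
  exact ⟨⟨hDm, h₁, h₂⟩, ht, rfl⟩

lemma mem_MF_of_D_mem_MF {m : Word} (hd : Diffble m) (ht : TightStart m)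
    (ht' : TightStart m.reverse) (hm : D m ∈ MF Cinf) : m ∈ MF Cinf := by
  obtain ⟨hm₀, hm₁, hm₂⟩ := hm
  rw [← D_dropLast_of_tightStart hd ht'] at hm₁
  rw [← D_tail_of_tightStart hd ht] at hm₂
  exact ⟨fun h => hm₀ (mem_Cinf_iff_D.1 h).2, mem_Cinf_iff_D.2 ⟨hd.dropLast, hm₁⟩,
    mem_Cinf_iff_D.2 ⟨hd.tail, hm₂⟩⟩

lemma cube_prefix_of_not_diffble {m : Word} (hm : IsWord m) (hd : ¬ Diffble m)
    (ht : Diffble m.tail) : ∃ a, IsLetter a ∧ [a, a, a] <+: m := by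
  rcases m with _ | ⟨a, t⟩
  · exact absurd ht hd
  · obtain ⟨ha, -⟩ := isWord_cons.1 hm
    obtain ⟨b, s, hb, hs, rfl⟩ := diffble_iff_expand.1 ht
    refine ⟨a, ha, ?_⟩
    rw [diffble_iff_expand] at hd
    rcases s with _ | ⟨n, s⟩
    · exact absurd ⟨a, [1], ha, by simp [IsWord], rfl⟩ hd
    · obtain ⟨hn, hs'⟩ := isWord_cons.1 hs
      by_cases hab : a = b
      · subst hab
        rcases hn with rfl | rfl
        · exact absurd ⟨a, 2 :: s, ha, isWord_cons.2 ⟨Or.inr rfl, hs'⟩, rfl⟩ hd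
        · exact ⟨expand (bar a) s, by simp [expand, List.replicate]⟩
      · rw [ha.eq_bar_of_ne hb hab] at hd
        exact absurd ⟨a, 1 :: n :: s, ha, isWord_cons.2 ⟨Or.inl rfl, hs⟩, rfl⟩ hd

lemma tightStart_of_length_lt {w : Word} (h : w.length < 3) : TightStart w :=
  fun a b _ hp => by
    have := hp.length_le
    simp at this
    omega

lemma rle_cube {a : ℕ} (ha : IsLetter a) : rle [a, a, a] = [3] :=
  rle_expand (r := [3]) ha (by simp)

lemma not_diffble_cube {a : ℕ} (ha : IsLetter a) : ¬ Diffble [a, a, a] := by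
  rw [Diffble, rle_cube ha]
  simp [IsWord]

lemma hereditarilyTight_of_length_lt {w : Word} (hw : w ∈ Cinf) (h : w.length < 3) :
    HereditarilyTight w := by
  induction hn : w.length using Nat.strong_induction_on generalizing w with
  | _ n ih =>
    by_cases hw₀ : w = []
    · subst hw₀; exact hereditarilyTight_nil
    obtain ⟨hwd, hwD⟩ := mem_Cinf_iff_D.1 hw
    have hlt := length_D_lt hwd hw₀
    exact hereditarilyTight_iff.2
      ⟨tightStart_of_length_lt h, ih _ (hn ▸ hlt) hwD (hlt.trans h) rfl⟩

lemma not_diffble_of_cube_prefix {a : ℕ} (ha : IsLetter a) {w : Word} (hw : Diffble w) :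
    ¬ [a, a, a] <+: w := by
  intro h
  induction hn : w.length generalizing w with
  | zero => simp [List.length_eq_zero_iff.1 hn] at h
  | succ n ih =>
    by_cases hvw : [a, a, a] = w
    · exact not_diffble_cube ha (hvw ▸ hw)
    · exact ih hw.dropLast (prefix_dropLast_of_ne h hvw) (by simp [hn])

lemma HereditarilyTight.of_prefix_MF {w m : Word} (hw : w ∈ Cinf) (hm : m ∈ MF Cinf)
    (hwm : w <+: m) (hne : w ≠ m) : HereditarilyTight w := by
  induction hn : w.length using Nat.strong_induction_on generalizing w m with
  | _ n ih =>
    by_cases hw₀ : w = []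
    · subst hw₀; exact hereditarilyTight_nil
    obtain ⟨hwd, hwD⟩ := mem_Cinf_iff_D.1 hw
    by_cases hd : Diffble m
    · obtain ⟨hDm, ht, hdrop⟩ := D_mem_MF hm hd
      refine hereditarilyTight_iff.2 ⟨ht.of_prefix hwm, ?_⟩
      refine ih _ (hn ▸ length_D_lt hwd hw₀) hwD hDm (hd.D_prefix hwm) (fun h => ?_) rfl
      have hp := ((mem_Cinf_iff_D.1 hm.2.1).1.D_prefix (prefix_dropLast_of_ne hwm hne)).length_le
      have hDm₀ : D m ≠ [] := fun h => hDm.1 (h ▸ nil_mem_Cinf)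
      have := List.length_pos_iff.2 hDm₀
      rw [h, hdrop, List.length_dropLast] at hp
      omega
    · obtain ⟨a, ha, hcube⟩ := cube_prefix_of_not_diffble (MF.isWord hm hwm hne hw₀) hd
        (mem_Cinf_iff_D.1 hm.2.2).1
      refine hereditarilyTight_of_length_lt hw (not_le.1 fun h => ?_)
      exact not_diffble_of_cube_prefix ha hwd (List.prefix_of_prefix_length_le hcube hwm h)

/-- Duplicate a leading `1`: a right inverse of `trimLeft` with values avoiding the prefix `12`. -/
def padLeft : List ℕ → List ℕ
  | [] => []
  | n :: r => if n = 1 then 1 :: n :: r else n :: r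

/-- Duplicate a trailing `1`. -/
def padRight (r : List ℕ) : List ℕ := (padLeft r.reverse).reverse

lemma trimLeft_padLeft (r : List ℕ) : trimLeft (padLeft r) = r := by
  rcases r with _ | ⟨n, r⟩
  · rfl
  · by_cases hn : n = 1 <;> simp [padLeft, trimLeft, hn]

lemma trimRight_padRight (r : List ℕ) : trimRight (padRight r) = r := by
  simp [trimRight, padRight, trimLeft_padLeft]

lemma not_prefix_padLeft_append {r : List ℕ} (hr : r ≠ []) (s : List ℕ) :
    ¬ [1, 2] <+: padLeft r ++ s := by
  rcases r with _ | ⟨n, r⟩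
  · exact absurd rfl hr
  · by_cases hn : n = 1 <;> simp [padLeft, hn, eq_comm (a := 1)]

lemma isWord_padLeft {r : List ℕ} (hr : IsWord r) : IsWord (padLeft r) := by
  rcases r with _ | ⟨n, r⟩
  · exact hr
  · simp only [padLeft]
    split_ifs
    · exact isWord_cons.2 ⟨Or.inl rfl, hr⟩
    · exact hr

lemma isWord_padRight {r : List ℕ} (hr : IsWord r) : IsWord (padRight r) :=
  isWord_reverse.2 (isWord_padLeft (isWord_reverse.2 hr))

lemma padLeft_append {r : List ℕ} (hr : r ≠ []) (s : List ℕ) :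
    padLeft (r ++ s) = padLeft r ++ s := by
  rcases r with _ | ⟨n, r⟩
  · exact absurd rfl hr
  · simp only [padLeft, List.cons_append]
    split_ifs <;> rfl

lemma padLeft_eq_append (r : List ℕ) : ∃ e, padLeft r = e ++ r := by
  rcases r with _ | ⟨n, r⟩
  · exact ⟨[], rfl⟩
  · by_cases hn : n = 1
    · exact ⟨[1], by simp [padLeft, hn]⟩
    · exact ⟨[], by simp [padLeft, hn]⟩

lemma padRight_append {s : List ℕ} (hs : s ≠ []) (r : List ℕ) :
    padRight (r ++ s) = r ++ padRight s := by
  simp [padRight, padLeft_append (List.reverse_ne_nil_iff.2 hs)]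

lemma padLeft_trimLeft {r : List ℕ} (hr : IsWord r) (h : ¬ [1, 2] <+: r) (hne : trimLeft r ≠ []) :
    padLeft (trimLeft r) = r := by
  rcases r with _ | ⟨n, r⟩
  · rfl
  · rcases (isWord_cons.1 hr).1 with rfl | rfl
    · rcases r with _ | ⟨m, r⟩
      · exact absurd rfl hne
      · rcases (isWord_cons.1 (isWord_cons.1 hr).2).1 with rfl | rfl
        · rfl
        · exact absurd ⟨r, rfl⟩ h
    · rfl

lemma trimRight_eq_self_or (r : List ℕ) : r = trimRight r ∨ r = trimRight r ++ [1] := by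
  rcases List.eq_nil_or_concat r with rfl | ⟨s, n, rfl⟩
  · exact Or.inl rfl
  · rw [List.concat_eq_append, trimRight_concat]
    by_cases hn : n = 1 <;> simp [hn]

lemma trimLeft_suffix (r : List ℕ) : trimLeft r <:+ r := by
  rcases r with _ | ⟨n, r⟩
  · exact List.suffix_rfl
  · simp only [trimLeft]
    split_ifs
    · exact List.suffix_cons n r
    · exact List.suffix_rfl

lemma padRight_trimRight {r : List ℕ} (hr : IsWord r) (h : ¬ [1, 2] <+: r.reverse)
    (hne : trimRight r ≠ []) : padRight (trimRight r) = r := by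
  rw [padRight, trimRight, List.reverse_reverse,
    padLeft_trimLeft (isWord_reverse.2 hr) h (by simpa [trimRight] using hne), List.reverse_reverse]

lemma rle_eq_pad {r : List ℕ} (hr : IsWord r) (h : ¬ [1, 2] <+: r) (h' : ¬ [1, 2] <+: r.reverse)
    (hne : trimRight (trimLeft r) ≠ []) : r = padLeft (padRight (trimRight (trimLeft r))) := by
  have hsuf := trimLeft_suffix r
  rw [padRight_trimRight (fun x hx => hr x (hsuf.subset hx))
    (fun hp => h' (hp.trans (List.reverse_prefix.2 hsuf))) hne, padLeft_trimLeft hr h]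
  intro h₀
  rw [h₀] at hne
  exact hne rfl

lemma Diffble.tightStart_iff {w : Word} (hw : Diffble w) : TightStart w ↔ ¬ [1, 2] <+: rle w := by
  obtain ⟨a, r, ha, hr, rfl⟩ := diffble_iff_expand.1 hw
  rw [tightStart_expand ha hr, rle_expand ha hr.zero_notMem]

lemma Diffble.tightStart_reverse_iff {w : Word} (hw : Diffble w) :
    TightStart w.reverse ↔ ¬ [1, 2] <+: (rle w).reverse := by
  rw [(diffble_reverse.2 hw).tightStart_iff, rle_reverse]

lemma sum_rle {w : Word} (hw : Diffble w) : (rle w).sum = w.length := by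
  obtain ⟨a, r, ha, hr, rfl⟩ := diffble_iff_expand.1 hw
  rw [rle_expand ha hr.zero_notMem, length_expand]

lemma length_le_of_tight {v v' : Word} (hv : Diffble v) (ht : TightStart v)
    (ht' : TightStart v.reverse) (hv' : Diffble v') (hD : D v' = D v) (hne : D v ≠ []) :
    v.length ≤ v'.length := by
  induction hn : v'.length using Nat.strong_induction_on generalizing v' with
  | _ n ih =>
    have hpos : 0 < v'.length := List.length_pos_iff.2 fun h => hne (by rw [← hD, h, D_nil])
    by_cases h : TightStart v'
    · by_cases h' : TightStart v'.reverse
      · have key : ∀ {w : Word}, Diffble w → TightStart w → TightStart w.reverse → D w ≠ [] →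
            rle w = padLeft (padRight (D w)) := fun {w} hw h₁ h₂ h₃ => by
          rw [D_eq_trim] at h₃ ⊢
          exact rle_eq_pad hw.2 (hw.tightStart_iff.1 h₁) (hw.tightStart_reverse_iff.1 h₂) h₃
        rw [← hn, ← sum_rle hv, ← sum_rle hv', key hv ht ht' hne, key hv' h h' (hD ▸ hne), hD]
      · have := ih v'.dropLast.length (by rw [List.length_dropLast]; omega) hv'.dropLast
          ((D_dropLast_of_not_tightStart hv' h').trans hD) rfl
        rw [List.length_dropLast] at this
        omega
    · have := ih v'.tail.length (by rw [List.length_tail]; omega) hv'.tail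
        ((D_tail_of_not_tightStart hv' h).trans hD) rfl
      rw [List.length_tail] at this
      omega

lemma expand_append (a : ℕ) (r s : List ℕ) :
    expand a (r ++ s) = expand a r ++ expand (bar^[r.length] a) s := by
  induction r generalizing a with
  | nil => rfl
  | cons n r ih => simp [expand, ih]

lemma two_le_sum_padRight {c : ℕ} {z : List ℕ} (h : IsWord (c :: z)) :
    2 ≤ (padRight (c :: z)).sum := by
  by_cases hz : z = []
  · subst hz
    rcases (isWord_cons.1 h).1 with rfl | rfl <;> decide
  · have h₁ := length_le_sum (isWord_padRight h)
    obtain ⟨e, he⟩ := padLeft_eq_append (c :: z).reverse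
    have h₂ : (c :: z).length ≤ (padRight (c :: z)).length := by
      rw [padRight, he]
      simp
    have := List.length_pos_iff.2 hz
    rw [List.length_cons] at h₂
    omega

lemma expand_one_prefix (a : ℕ) {c : ℕ} {z : List ℕ} (h : IsWord (c :: z)) :
    expand a [1] <+: expand a (padRight (c :: z)) := by
  have hp : [c] <+: padRight (c :: z) := by
    obtain ⟨e, he⟩ := padLeft_eq_append (c :: z).reverse
    rw [padRight, he]
    simp
  obtain ⟨q, hq⟩ := hp
  rw [← hq]
  rcases (isWord_cons.1 h).1 with rfl | rfl <;> simp [expand, List.replicate]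

lemma diffble_expand {a : ℕ} (ha : IsLetter a) {r : List ℕ} (hr : IsWord r) :
    Diffble (expand a r) := diffble_iff_expand.2 ⟨a, r, ha, hr, rfl⟩

lemma exists_tight_primitive {w x : Word} (hw : Diffble w) (ht : TightStart w) (hne : D w ≠ [])
    (hx : IsWord x) (hwx : D w <+: x) (hne' : D w ≠ x) :
    ∃ v, Diffble v ∧ TightStart v ∧ TightStart v.reverse ∧ D v = x ∧ w <+: v ∧ w ≠ v := by
  obtain ⟨a, r, ha, hr, rfl⟩ := diffble_iff_expand.1 hw
  rw [tightStart_expand ha hr] at ht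
  rw [D_expand ha hr] at hne hwx hne'
  have hP : IsWord (padLeft (padRight x)) := isWord_padLeft (isWord_padRight hx)
  have hx₀ : x ≠ [] := by
    rintro rfl
    exact hne (List.prefix_nil.1 hwx)
  have hpad : padRight x ≠ [] := by
    intro h
    apply hx₀
    rw [← trimRight_padRight x, h, trimRight_nil]
  have hv := diffble_expand ha hP
  refine ⟨expand a (padLeft (padRight x)), hv, ?_, ?_, ?_, ?_⟩
  · rw [tightStart_expand ha hP]
    simpa using not_prefix_padLeft_append hpad []
  · rw [hv.tightStart_reverse_iff, rle_expand ha hP.zero_notMem]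
    obtain ⟨e, he⟩ := padLeft_eq_append (padRight x)
    rw [he, List.reverse_append, padRight, List.reverse_reverse]
    exact not_prefix_padLeft_append (List.reverse_ne_nil_iff.2 hx₀) _
  · rw [D_expand ha hP, trimLeft_padLeft, trimRight_padRight]
  · have hy : trimLeft r ≠ [] := by
      intro h
      rw [h] at hne
      exact hne rfl
    rw [← padLeft_trimLeft hr ht hy]
    obtain ⟨q, rfl⟩ := hwx
    rcases q with _ | ⟨c, z⟩
    · simp at hne'
    rw [padRight_append (List.cons_ne_nil c z), padLeft_append hne]
    rw [expand_append]
    have hcz := (isWord_append.1 hx).2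
    have hlt : ∀ t : List ℕ, t.sum ≤ 1 →
        expand a (padLeft (trimRight (trimLeft r)) ++ t) ≠ expand a (padLeft (trimRight (trimLeft r)))
          ++ expand (bar^[(padLeft (trimRight (trimLeft r))).length] a) (padRight (c :: z)) := by
      intro t ht h
      have := congrArg List.length h
      rw [expand_append, List.length_append, List.length_append, length_expand _ t,
        length_expand _ (padRight _)] at this
      have := two_le_sum_padRight hcz
      omega
    rcases trimRight_eq_self_or (trimLeft r) with h | h
    · have h₁ := hlt [] (by simp)
      rw [List.append_nil] at h₁
      rw [← h] at h₁ ⊢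
      exact ⟨List.prefix_append _ _, h₁⟩
    · have h₁ := hlt [1] (by simp)
      rw [← padLeft_append hne, ← h] at h₁
      refine ⟨?_, h₁⟩
      conv_lhs => rw [h, padLeft_append hne, expand_append]
      rw [List.prefix_append_right_inj]
      exact expand_one_prefix _ hcz

lemma exists_iterate_D_eq_nil {w : Word} (hw : w ∈ Cinf) : ∃ k, D^[k] w = [] := by
  induction hn : w.length using Nat.strong_induction_on generalizing w with
  | _ n ih =>
    by_cases hw₀ : w = []
    · exact ⟨0, hw₀⟩
    obtain ⟨hwd, hwD⟩ := mem_Cinf_iff_D.1 hw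
    obtain ⟨k, hk⟩ := ih _ (hn ▸ length_D_lt hwd hw₀) hwD rfl
    exact ⟨k + 1, hk⟩

lemma lt_height_iff {w : Word} (hw : w ∈ Cinf) {j : ℕ} : j < height w ↔ D^[j] w ≠ [] := by
  constructor
  · exact fun h h' => Nat.notMem_of_lt_sInf h h'
  · intro h
    by_contra! hle
    obtain ⟨k, hk⟩ := Nat.exists_eq_add_of_le hle
    apply h
    have h₀ : D^[height w] w = [] := Nat.sInf_mem (exists_iterate_D_eq_nil hw)
    rw [hk, Nat.add_comm, Function.iterate_add_apply, h₀, iterate_D_nil]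

lemma minimalWord_iff {w : Word} : MinimalWord w ↔ w ∈ Cinf ∧ w ≠ [] ∧
    ∀ j, D^[j + 1] w ≠ [] → ∀ v, IsPrimitive v (D^[j + 1] w) → (D^[j] w).length ≤ v.length := by
  refine and_congr_right fun hw => and_congr_right fun _ => forall_congr' fun j => ?_
  rw [← lt_height_iff hw]
  rfl

lemma MinimalWord.hereditarilyTight {w : Word} (hw : MinimalWord w) : HereditarilyTight w := by
  obtain ⟨hC, -, hmin⟩ := minimalWord_iff.1 hw
  intro j
  by_contra ht
  have hd := mem_Cinf_iff.1 hC j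
  have hne := D_ne_nil_of_not_tightStart hd ht
  rw [← Function.iterate_succ_apply' D] at hne
  have hle := hmin j hne (D^[j] w).tail
    ⟨hd.tail, by rw [D_tail_of_not_tightStart hd ht, ← Function.iterate_succ_apply' D]⟩
  have hpos : 0 < (D^[j] w).length :=
    List.length_pos_iff.2 fun h => by
      rw [Function.iterate_succ_apply', h] at hne
      exact hne rfl
  rw [List.length_tail] at hle
  omega

lemma minimalWord_of_D_minimalWord {w : Word} (hd : Diffble w) (ht : TightStart w)
    (ht' : TightStart w.reverse) (hw : MinimalWord (D w)) : MinimalWord w := by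
  rw [minimalWord_iff] at hw ⊢
  obtain ⟨hC, hne, hmin⟩ := hw
  refine ⟨mem_Cinf_iff_D.2 ⟨hd, hC⟩, fun h => hne (by rw [h, D_nil]), fun j hj v hv => ?_⟩
  cases j with
  | zero => exact length_le_of_tight hd ht ht' hv.1 hv.2 hne
  | succ j => exact hmin j hj v hv

lemma minimalWord_of_D_eq_nil {w : Word} (hd : Diffble w) (hne : w ≠ []) (hD : D w = []) :
    MinimalWord w :=
  minimalWord_iff.2 ⟨mem_Cinf_iff_D.2 ⟨hd, hD ▸ nil_mem_Cinf⟩, hne, fun j hj =>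
    absurd (by rw [Function.iterate_succ_apply, hD, iterate_D_nil]) hj⟩

lemma eq_expand_of_D_eq_nil {w : Word} (hw : Diffble w) (hne : w ≠ []) (hD : D w = []) :
    ∃ a, IsLetter a ∧ (w = expand a [1] ∨ w = expand a [1, 1]) := by
  obtain ⟨a, r, ha, hr, rfl⟩ := diffble_iff_expand.1 hw
  refine ⟨a, ha, ?_⟩
  rw [D_expand ha hr] at hD
  rcases r with _ | ⟨n, s⟩
  · exact absurd rfl hne
  · rcases (isWord_cons.1 hr).1 with rfl | rfl
    · change trimRight s = [] at hD
      rcases trimRight_eq_self_or s with h | h <;> rw [hD] at h <;> subst h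
      · exact Or.inl rfl
      · exact Or.inr rfl
    · change trimRight (2 :: s) = [] at hD
      simp [trimRight_two_cons] at hD

/-- Any class of words which is closed under tight primitives and strictly extends the tight words
with empty derivative strictly extends all nonempty hereditarily tight words. -/
lemma exists_strict_extension {S : Set Word}
    (hword : ∀ w x, x ∈ S → w <+: x → w ≠ x → w ≠ [] → IsWord x)
    (hbase₁ : ∀ a, IsLetter a → ∃ x ∈ S, expand a [1] <+: x ∧ expand a [1] ≠ x)
    (hbase₂ : ∀ a, IsLetter a → ∃ x ∈ S, expand a [1, 1] <+: x ∧ expand a [1, 1] ≠ x)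
    (hstep : ∀ v, Diffble v → TightStart v → TightStart v.reverse → D v ∈ S → v ∈ S)
    {w : Word} (hw : w ∈ Cinf) (hne : w ≠ []) (ht : HereditarilyTight w) :
    ∃ x ∈ S, w <+: x ∧ w ≠ x := by
  induction hn : w.length using Nat.strong_induction_on generalizing w with
  | _ n ih =>
    obtain ⟨hwd, hwD⟩ := mem_Cinf_iff_D.1 hw
    by_cases hD : D w = []
    · obtain ⟨a, ha, rfl | rfl⟩ := eq_expand_of_D_eq_nil hwd hne hD
      · exact hbase₁ a ha
      · exact hbase₂ a ha
    · obtain ⟨ht₀, htD⟩ := hereditarilyTight_iff.1 ht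
      obtain ⟨x, hxS, hpre, hneq⟩ := ih _ (hn ▸ length_D_lt hwd hne) hwD hD htD rfl
      obtain ⟨v, hv, h₁, h₂, rfl, h₃, h₄⟩ := exists_tight_primitive hwd ht₀ hD
        (hword _ x hxS hpre hneq hD) hpre hneq
      exact ⟨v, hstep v hv h₁ h₂ hxS, h₃, h₄⟩

lemma expand_mem_of_step {S : Set Word}
    (hstep : ∀ v, Diffble v → TightStart v → TightStart v.reverse → D v ∈ S → v ∈ S)
    {a : ℕ} (ha : IsLetter a) {r : List ℕ} (hr : IsWord r) (h : ¬ [1, 2] <+: r)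
    (h' : ¬ [1, 2] <+: r.reverse) (hS : trimRight (trimLeft r) ∈ S) : expand a r ∈ S := by
  have hd := diffble_expand ha hr
  have hrle := rle_expand ha hr.zero_notMem
  refine hstep _ hd (hd.tightStart_iff.2 (by rwa [hrle])) (hd.tightStart_reverse_iff.2 (by rwa [hrle])) ?_
  rwa [D_expand ha hr]

lemma isLetter_one : IsLetter 1 := Or.inl rfl

lemma isLetter_two : IsLetter 2 := Or.inr rfl

lemma minimalWord_singleton {a : ℕ} (ha : IsLetter a) : MinimalWord [a] := by
  have h : IsWord [1] := by simp [IsWord]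
  refine minimalWord_of_D_eq_nil (diffble_expand (r := [1]) ha h) (by simp) ?_
  exact D_expand (r := [1]) ha h

lemma cube_mem_MF {a : ℕ} (ha : IsLetter a) : [a, a, a] ∈ MF Cinf := by
  have h : [a, a] ∈ Cinf :=
    (expand_mem_of_step (S := {w | MinimalWord w}) (fun _ => minimalWord_of_D_minimalWord) ha
      (r := [2]) (by simp [IsWord]) (by decide) (by decide) (minimalWord_singleton isLetter_two)).1
  exact ⟨fun h => not_diffble_cube ha (mem_Cinf_iff_D.1 h).1, h, h⟩

lemma LeftMinimal.hereditarilyTight {w : Word} (hw : LeftMinimal w) : HereditarilyTight w := by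
  obtain ⟨v, hv, hwv⟩ := hw
  exact hv.hereditarilyTight.of_prefix hv.1 hwv

lemma HereditarilyTight.leftMinimal {w : Word} (hw : w ∈ Cinf) (hne : w ≠ [])
    (ht : HereditarilyTight w) : LeftMinimal w := by
  have hstep : ∀ v, Diffble v → TightStart v → TightStart v.reverse →
      D v ∈ {w | MinimalWord w} → v ∈ {w | MinimalWord w} :=
    fun _ => minimalWord_of_D_minimalWord
  obtain ⟨x, hx, hwx, -⟩ := exists_strict_extension (S := {w | MinimalWord w})
    (fun _ x hx _ _ _ => (hx.1 0).1)
    (fun a ha => ⟨expand a [2], expand_mem_of_step hstep ha (by simp [IsWord]) (by decide)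
      (by decide) (minimalWord_singleton isLetter_two), by simp [expand, List.replicate]⟩)
    (fun a ha => ⟨expand a [1, 1, 1], expand_mem_of_step hstep ha (by simp [IsWord]) (by decide)
      (by decide) (minimalWord_singleton isLetter_one), by simp [expand, List.replicate]⟩)
    hstep hw hne ht
  exact ⟨x, hx, hwx⟩

lemma HereditarilyTight.exists_mem_MF {w : Word} (hw : w ∈ Cinf) (hne : w ≠ [])
    (ht : HereditarilyTight w) : ∃ m ∈ MF Cinf, w <+: m ∧ w ≠ m :=
  exists_strict_extension (fun _ _ => MF.isWord)
    (fun a ha => ⟨[a, a, a], cube_mem_MF ha, by simp [expand, List.replicate]⟩)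
    (fun a ha => ⟨expand a [1, 1, 1, 1, 1],
      expand_mem_of_step (fun _ => mem_MF_of_D_mem_MF) ha (by simp [IsWord]) (by decide)
        (by decide) (cube_mem_MF isLetter_one), by simp [expand, List.replicate]⟩)
    (fun _ => mem_MF_of_D_mem_MF) hw hne ht

end CinftyWords

open CinftyWords in
/-- A nonempty C∞-word is a proper prefix of some word of `MF(C∞)` iff it is a left
minimal word. -/
theorem proper_prefix_of_mf_iff_left_minimal (w : Word) (hw : w ∈ Cinf) (hne : w ≠ []) :
    (∃ m ∈ MF Cinf, w <+: m ∧ w ≠ m) ↔ LeftMinimal w := by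
  constructor
  · rintro ⟨m, hm, hwm, hne'⟩
    exact (HereditarilyTight.of_prefix_MF hw hm hwm hne').leftMinimal hw hne
  · exact fun h => h.hereditarilyTight.exists_mem_MF hw hne
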